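/- arXiv:math/0501063 — 2 statements merged into one kernel-verified Lean document; each statement's English description precedes it below -/
import Mathlib

section
/- Let R be a commutative Noetherian ring, a an ideal, r ≥ 0 an integer, and M a finitely generated R-module such that H_a^r(R/p) = 0 for all p ∈ Supp(M). Then cd(a, R/p) < r for all p ∈ Supp(M); in particular H_a^i(M) = 0 for all i ≥ r, so cd(a, M) < r. -/
noncomputable section

universe u

open CategoryTheory

/-- The `i`-th local cohomology of a module with respect to an ideal. -/
abbrev LC {R : Type u} [CommRing R] (J : Ideal R) (i : ℕ) (M : Type u)
    [AddCommGroup M] [Module R M] : ModuleCat.{u} R :=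
  (localCohomology J i).obj (ModuleCat.of R M)

/-- Attached primes of a module: primes of the form `Ann(T/U)`. -/
def Att (R : Type u) [CommRing R] (T : Type u) [AddCommGroup T] [Module R T] :
    Set (Ideal R) :=
  { p | p.IsPrime ∧ ∃ U : Submodule R T, p = Module.annihilator R (T ⧸ U) }

/-- Krull dimension of a module, as the Krull dimension of its support. -/
def mdim (R : Type u) [CommRing R] (M : Type u) [AddCommGroup M] [Module R M] :
    WithBot ℕ∞ :=
  Order.krullDim (Module.support R M)

/-- Cohomological dimension of `M` with respect to `J`:
the supremum of the `i` with `H_J^i(M) ≠ 0` (`⊥` if there are none). -/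
def cohDim (R : Type u) [CommRing R] (J : Ideal R) (M : Type u)
    [AddCommGroup M] [Module R M] : WithBot ℕ∞ :=
  sSup { x | ∃ i : ℕ, x = (i : ℕ∞) ∧ Nontrivial (LC J i M) }


section
open CategoryTheory Limits Opposite

theorem homπ_zero_iff {R : Type u} [CommRing R] (S : ShortComplex (ModuleCat.{u} R)) (z : S.cycles) :
    S.homologyπ z = 0 ↔ ∃ y : S.X₁, S.f y = S.iCycles z := by
  have ex : (ShortComplex.mk S.toCycles S.homologyπ (by simp)).Exact :=
    ShortComplex.exact_of_g_is_cokernel _ S.homologyIsCokernel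
  rw [ShortComplex.moduleCat_exact_iff] at ex
  constructor
  · intro h
    obtain ⟨y, hy⟩ := ex z h
    refine ⟨y, ?_⟩
    rw [← S.toCycles_i]
    exact congrArg S.iCycles hy
  · rintro ⟨y, hy⟩
    have : S.toCycles y = z := by
      apply (ModuleCat.mono_iff_injective S.iCycles).1 inferInstance
      rw [← hy, ← S.toCycles_i]; rfl
    rw [← this]
    exact congrArg (fun f => f.hom y) S.toCycles_comp_homologyπ

section
variable {R : Type u} [CommRing R]

/-- chain map on yoneda complexes -/
noncomputable def lyMap {K L : ChainComplex (ModuleCat.{u} R) ℕ} (φ : K ⟶ L) (N : ModuleCat.{u} R) :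
    L.linearYonedaObj R N ⟶ K.linearYonedaObj R N :=
  (HomologicalComplex.unopFunctor _ _).map
   (((((linearYoneda R (ModuleCat.{u} R)).obj N).rightOp.mapHomologicalComplex _).map φ).op)

theorem lyMap_f {K L : ChainComplex (ModuleCat.{u} R) ℕ} (φ : K ⟶ L) (N : ModuleCat.{u} R) (n : ℕ)
    (f : L.X n ⟶ N) : ((lyMap φ N).f n).hom f = φ.f n ≫ f := rfl

theorem comp_aux {C : Type*} [Category C] {A B D E F G : C} (e : A ⟶ B) (p : B ⟶ D) (p' : D ⟶ E)
    (q : A ⟶ F) (q' : F ⟶ G) (m : G ⟶ E) (k : F ⟶ D) (h3 : e ≫ p = q ≫ k)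
    (h4 : k ≫ p' = q' ≫ m) : e ≫ (p ≫ p') = (q ≫ q') ≫ m := by
  rw [← Category.assoc, h3, Category.assoc, h4, Category.assoc]

theorem isoExt_nat {X Y : ModuleCat.{u} R} (g : X ⟶ Y) (P : ProjectiveResolution X)
    (Q : ProjectiveResolution Y) (φ : P.complex ⟶ Q.complex)
    (comm : φ.f 0 ≫ Q.π.f 0 = P.π.f 0 ≫ g) (N : ModuleCat.{u} R) (n : ℕ) :
    ((Ext R (ModuleCat.{u} R) n).map g.op).app N ≫ (P.isoExt n N).hom =
      (Q.isoExt n N).hom ≫ HomologicalComplex.homologyMap (lyMap φ N) n := by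
  have h := ProjectiveResolution.isoLeftDerivedObj_inv_naturality g P Q φ comm
    ((linearYoneda R (ModuleCat.{u} R)).obj N).rightOp n
  have h2 := HomologicalComplex.homologyOp_hom_naturality (lyMap φ N) n
  have h2' := (Iso.inv_comp_eq _).2 (((Iso.eq_comp_inv _).2 h2).trans (Category.assoc _ _ _))
  have h3 := congrArg Quiver.Hom.unop h
  have h4 := congrArg Quiver.Hom.unop h2'
  exact comp_aux _ _ _ _ _ _ _ h3 h4

section
open Abelian
variable {X Y N : ModuleCat.{u} R} {n : ℕ}

theorem extMk_zero_iff₀ (P : ProjectiveResolution X) (f : P.complex.X 0 ⟶ N) (m : ℕ) (hm : 0 + 1 = m)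
    (hf : P.complex.d m 0 ≫ f = 0) : P.extMk f m hm hf = 0 ↔ f = 0 := by
  simp only [← P.extEquivCohomologyClass.apply_eq_iff_eq,
    ProjectiveResolution.extEquivCohomologyClass_extMk,
    ProjectiveResolution.extEquivCohomologyClass_zero,
    CochainComplex.HomComplex.CohomologyClass.mk_eq_zero_iff]
  rw [CochainComplex.HomComplex.Cocycle.toSingleMk_mem_coboundaries_iff _ _ _ _ _ 1 (by lia)]
  have hz : IsZero (P.cochainComplex.X 1) := CochainComplex.isZero_of_isStrictlyLE _ 0 _
  constructor
  · rintro ⟨g, hg⟩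
    rw [hz.eq_of_src g 0, comp_zero] at hg
    rw [← cancel_epi (P.cochainComplexXIso (-(0:ℕ)) 0 rfl).hom, ← hg, comp_zero]
  · rintro rfl
    exact ⟨0, by simp⟩

theorem cyc_cond (P : ProjectiveResolution X) (z : (P.complex.linearYonedaObj R N).cycles n) :
    P.complex.d (n+1) n ≫ ((P.complex.linearYonedaObj R N).iCycles n z : P.complex.X n ⟶ N) = 0 :=
  congrArg (fun f => f.hom z) ((P.complex.linearYonedaObj R N).iCycles_d n (n+1))

/-- relation between old and new Ext -/
def ERel (P : ProjectiveResolution X) (e : ((_root_.Ext R (ModuleCat.{u} R) n).obj (op X)).obj N)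
    (e' : Abelian.Ext X N n) : Prop :=
  ∃ z : (P.complex.linearYonedaObj R N).cycles n,
    (P.isoExt n N).hom e = (P.complex.linearYonedaObj R N).homologyπ n z ∧
    e' = P.extMk ((P.complex.linearYonedaObj R N).iCycles n z : P.complex.X n ⟶ N) (n+1) rfl
      (cyc_cond P z)

theorem ERel.left (P : ProjectiveResolution X)
    (e : ((_root_.Ext R (ModuleCat.{u} R) n).obj (op X)).obj N) : ∃ e', ERel P e e' := by
  obtain ⟨z, hz⟩ := (ModuleCat.epi_iff_surjective
    ((P.complex.linearYonedaObj R N).homologyπ n)).1 inferInstance ((P.isoExt n N).hom e)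
  exact ⟨_, z, hz.symm, rfl⟩

theorem ERel.right (P : ProjectiveResolution X) (e' : Abelian.Ext X N n) :
    ∃ e : ((_root_.Ext R (ModuleCat.{u} R) n).obj (op X)).obj N, ERel P e e' := by
  obtain ⟨f, hf, rfl⟩ := P.extMk_surjective e' (n+1) rfl
  let K := P.complex.linearYonedaObj R N
  have hx : ((forget₂ (ModuleCat.{u} R) Ab).map (K.d n (n+1))) f = 0 := hf
  have := K.i_cyclesMk (i := n) f (n+1) (by simp) hx
  refine ⟨(P.isoExt n N).inv (K.homologyπ n (K.cyclesMk (i := n) f (n+1) (by simp) hx)),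
    K.cyclesMk (i := n) f (n+1) (by simp) hx, by simp [K], ?_⟩
  congr 1
  exact this.symm

theorem ERel.zero_iff {P : ProjectiveResolution X}
    {e : ((_root_.Ext R (ModuleCat.{u} R) n).obj (op X)).obj N}
    {e' : Abelian.Ext X N n} (h : ERel P e e') : e = 0 ↔ e' = 0 := by
  obtain ⟨z, h1, rfl⟩ := h
  have : e = 0 ↔ (P.isoExt n N).hom e = 0 :=
    (map_eq_zero_iff _ (P.isoExt n N).toLinearEquiv.injective).symm
  rw [this, h1]
  refine (homπ_zero_iff ((P.complex.linearYonedaObj R N).sc n) z).trans ?_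
  rcases n with _ | p
  · refine Iff.trans ?_ (extMk_zero_iff₀ P _ 1 rfl _).symm
    have hd : (P.complex.linearYonedaObj R N).d ((ComplexShape.up ℕ).prev 0) 0 = 0 :=
      HomologicalComplex.shape _ _ _ (by simp)
    constructor
    · rintro ⟨y, hy⟩
      refine Eq.trans hy.symm ?_
      change (ModuleCat.Hom.hom ((P.complex.linearYonedaObj R N).d ((ComplexShape.up ℕ).prev 0) 0)) y = 0
      rw [hd]; rfl
    · intro h
      exact ⟨0, by rw [map_zero]; exact h.symm⟩
  · refine Iff.trans ?_ (ProjectiveResolution.extMk_eq_zero_iff P _ _ _ _ p rfl).symm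
    have hp : (ComplexShape.up ℕ).prev (p+1) = p := by simp
    change (∃ y : (P.complex.linearYonedaObj R N).X ((ComplexShape.up ℕ).prev (p+1)),
      (P.complex.linearYonedaObj R N).d ((ComplexShape.up ℕ).prev (p+1)) (p+1) y =
        (P.complex.linearYonedaObj R N).iCycles (p+1) z) ↔ _
    rw [hp]
    rfl

theorem ERel.map {g : X ⟶ Y} {P : ProjectiveResolution X} {Q : ProjectiveResolution Y}
    (φ : ProjectiveResolution.Hom P Q g)
    {e : ((_root_.Ext R (ModuleCat.{u} R) n).obj (op Y)).obj N} {e' : Abelian.Ext Y N n}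
    (h : ERel Q e e') :
    ERel P (((_root_.Ext R (ModuleCat.{u} R) n).map g.op).app N e)
      ((Ext.mk₀ g).comp e' (zero_add n)) := by
  obtain ⟨z, h1, rfl⟩ := h
  refine ⟨HomologicalComplex.cyclesMap (lyMap φ.hom N) n z, ?_, ?_⟩
  · have := congrArg (fun f => f.hom e) (isoExt_nat g P Q φ.hom
      (by simpa using φ.hom_f_zero_comp_π_f_zero) N n)
    refine this.trans ?_
    refine (congrArg (HomologicalComplex.homologyMap (lyMap φ.hom N) n) h1).trans ?_
    exact congrArg (fun f => f.hom z) (HomologicalComplex.homologyπ_naturality (lyMap φ.hom N) n)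
  · refine (ProjectiveResolution.mk₀_comp_extMk _ _ _ _ φ).trans ?_
    congr 1
    exact (congrArg (fun f => f.hom z) (HomologicalComplex.cyclesMap_i (lyMap φ.hom N) n)).symm
end
end

section
variable {R : Type u} [CommRing R]
open Abelian

/-- the object `R/a^t` -/
noncomputable abbrev Q (a : Ideal R) (t : ℕ) : ModuleCat.{u} R := ModuleCat.of R (R ⧸ a ^ t)

/-- the projection -/
noncomputable def pr (a : Ideal R) {t s : ℕ} (h : t ≤ s) : Q a s ⟶ Q a t :=
  ModuleCat.ofHom (Submodule.mapQ _ _ LinearMap.id (Ideal.pow_le_pow_right h))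

/-- vanishing of local cohomology, elementwise -/
def Van (a : Ideal R) (i : ℕ) (N : ModuleCat.{u} R) : Prop :=
  ∀ (t : ℕ) (e : Abelian.Ext (Q a t) N i), ∃ (s : ℕ) (h : t ≤ s),
    (Ext.mk₀ (pr a h)).comp e (zero_add i) = 0

theorem homExists {X Y : ModuleCat.{u} R} (g : X ⟶ Y) (P : ProjectiveResolution X)
    (Q : ProjectiveResolution Y) : Nonempty (ProjectiveResolution.Hom P Q g) :=
  ⟨⟨ProjectiveResolution.lift g P Q, by
    rw [← HomologicalComplex.comp_f, ProjectiveResolution.lift_commutes, HomologicalComplex.comp_f]⟩⟩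

theorem lc_iff (a : Ideal R) (i : ℕ) (N : Type u) [AddCommGroup N] [Module R N] :
    Subsingleton (LC a i N) ↔ Van a i (ModuleCat.of R N) := by
  let D := localCohomology.diagram (localCohomology.idealPowersDiagram a) i
  let F : (ℕᵒᵖ)ᵒᵖ ⥤ ModuleCat.{u} R := D ⋙ (evaluation _ _).obj (ModuleCat.of R N)
  have iso : LC a i N ≅ colimit F := colimitObjIsoColimitCompEvaluation D (ModuleCat.of R N)
  have h0 : Subsingleton (LC a i N) ↔ Subsingleton (colimit F : ModuleCat.{u} R) :=
    iso.toLinearEquiv.toEquiv.subsingleton_congr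
  have hF : ∀ (t s : ℕ) (h : t ≤ s), F.map (homOfLE h).op.op =
    ((_root_.Ext R (ModuleCat.{u} R) i).map (pr a h).op).app (ModuleCat.of R N) := fun _ _ _ => rfl
  let P (t : ℕ) := projectiveResolution (Q a t)
  have : PreservesFilteredColimitsOfSize.{0, 0} (forget (ModuleCat.{u} R)) :=
    preservesFilteredColimitsOfSize_shrink.{0, u, 0, u} _
  have : PreservesColimit F (forget (ModuleCat.{u} R)) := inferInstance
  rw [h0]
  constructor
  · intro hs t e
    obtain ⟨e0, he0⟩ := ERel.right (P t) e
    obtain ⟨j, f, hj⟩ := Concrete.colimit_rep_eq_zero R F (op (op t)) e0 (Subsingleton.elim _ _)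
    obtain ⟨s, rfl⟩ : ∃ s : ℕ, j = op (op s) := ⟨j.unop.unop, rfl⟩
    have h : t ≤ s := leOfHom f.unop.unop
    refine ⟨s, h, ?_⟩
    obtain ⟨φ⟩ := homExists (pr a h) (P s) (P t)
    refine (he0.map φ).zero_iff.1 ?_
    exact hj
  · intro hv
    refine subsingleton_of_forall_eq 0 fun x => ?_
    obtain ⟨j, y, rfl⟩ := Concrete.colimit_exists_rep F x
    obtain ⟨t, rfl⟩ : ∃ s : ℕ, j = op (op s) := ⟨j.unop.unop, rfl⟩
    obtain ⟨e, he⟩ := ERel.left (P t) y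
    obtain ⟨s, h, hs⟩ := hv t e
    obtain ⟨φ⟩ := homExists (pr a h) (P s) (P t)
    have := (he.map φ).zero_iff.2 hs
    have h2 := congrArg (fun f => f.hom y) (colimit.w F (homOfLE h).op.op)
    refine h2.symm.trans ?_
    refine (congrArg (colimit.ι F (op (op s))) this).trans (map_zero _)
end

section
variable {R : Type u} [CommRing R] (a : Ideal R)
open Abelian

theorem pr_comp {t s w : ℕ} (h : t ≤ s) (h' : s ≤ w) : pr a h' ≫ pr a h = pr a (h.trans h') := by
  ext x
  rfl

variable {a}

theorem pr_pr {t s w : ℕ} (h : t ≤ s) (h' : s ≤ w) {N : ModuleCat.{u} R} {i : ℕ}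
    (e : Abelian.Ext (Q a t) N i) :
    (Ext.mk₀ (pr a h')).comp ((Ext.mk₀ (pr a h)).comp e (zero_add i)) (zero_add i) =
    (Ext.mk₀ (pr a (h.trans h'))).comp e (zero_add i) := by
  rw [← pr_comp a h h', ← Ext.mk₀_comp_mk₀_assoc]

theorem van_mid {S : ShortComplex (ModuleCat.{u} R)} (hS : S.ShortExact) {i : ℕ}
    (h1 : Van a i S.X₁) (h3 : Van a i S.X₃) : Van a i S.X₂ := by
  intro t e
  obtain ⟨s, h, hs⟩ := h3 t (e.comp (Ext.mk₀ S.g) (add_zero i))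
  rw [← Ext.comp_assoc _ _ _ (zero_add i) (add_zero i) (by simp)] at hs
  obtain ⟨e1, he1⟩ := Ext.covariant_sequence_exact₂ _ hS _ hs
  obtain ⟨w, h', hw⟩ := h1 s e1
  refine ⟨w, h.trans h', ?_⟩
  rw [← pr_pr h h', ← he1, ← Ext.comp_assoc _ _ _ (zero_add i) (add_zero i) (by simp), hw,
    Ext.zero_comp]

theorem van_inj {S : ShortComplex (ModuleCat.{u} R)} (hS : S.ShortExact) {i : ℕ}
    (h3 : Van a i S.X₃) {t : ℕ} (e : Abelian.Ext (Q a t) S.X₁ (i+1))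
    (he : e.comp (Ext.mk₀ S.f) (add_zero _) = 0) :
    ∃ (s : ℕ) (h : t ≤ s), (Ext.mk₀ (pr a h)).comp e (zero_add _) = 0 := by
  obtain ⟨x, rfl⟩ := Ext.covariant_sequence_exact₁ _ hS _ he rfl
  obtain ⟨s, h, hs⟩ := h3 t x
  refine ⟨s, h, ?_⟩
  rw [← Ext.comp_assoc _ _ _ (zero_add i) rfl (by simp), hs, Ext.zero_comp]

theorem van_iso {N N' : ModuleCat.{u} R} (φ : N ≅ N') {i : ℕ} (h : Van a i N) : Van a i N' := by
  intro t e
  obtain ⟨s, hh, hs⟩ := h t (e.comp (Ext.mk₀ φ.inv) (add_zero i))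
  refine ⟨s, hh, ?_⟩
  have := congrArg (fun z => Ext.comp z (Ext.mk₀ φ.hom) (add_zero i)) hs
  simpa using this

theorem van_sub {N : ModuleCat.{u} R} [Subsingleton N] {i : ℕ} : Van a i N := by
  intro t e
  refine ⟨t, le_rfl, ?_⟩
  have hz : (𝟙 N) = 0 := by ext x; exact Subsingleton.elim _ _
  have : e = 0 := by
    rw [← Ext.comp_mk₀_id e, hz, Ext.mk₀_zero, Ext.comp_zero]
  rw [this, Ext.comp_zero]

theorem tors {x : R} (hx : x ∈ a) {t i : ℕ} {N : ModuleCat.{u} R} (e : Abelian.Ext (Q a t) N i) :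
    x ^ t • e = 0 := by
  have hz : x ^ t • (𝟙 (Q a t)) = 0 := by
    ext
    change x ^ t • (Submodule.Quotient.mk 1 : R ⧸ a ^ t) = 0
    rw [← Submodule.Quotient.mk_smul, Submodule.Quotient.mk_eq_zero, smul_eq_mul, mul_one]
    exact Ideal.pow_mem_pow hx t
  have h : x ^ t • e = (Ext.mk₀ (x ^ t • (𝟙 (Q a t)))).comp e (zero_add i) := by
    rw [Ext.mk₀_smul, Ext.smul_comp, Ext.mk₀_id_comp]
  rw [h, hz, Ext.mk₀_zero, Ext.zero_comp]

theorem van_x {x : R} (hx : x ∈ a) {N C : ModuleCat.{u} R} (g : N ⟶ C)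
    (w : (x • 𝟙 N) ≫ g = 0) (hS : (ShortComplex.mk (x • 𝟙 N) g w).ShortExact) {i : ℕ}
    (h : Van a i C) : Van a (i+1) N := by
  have key : ∀ (k t : ℕ) (e : Abelian.Ext (Q a t) N (i+1)), x ^ k • e = 0 →
      ∃ (s : ℕ) (h : t ≤ s), (Ext.mk₀ (pr a h)).comp e (zero_add _) = 0 := by
    intro k
    induction k with
    | zero => intro t e he; exact ⟨t, le_rfl, by rw [pow_zero, one_smul] at he; rw [he, Ext.comp_zero]⟩
    | succ k ih =>
      intro t e he
      obtain ⟨s, h1, hs⟩ := van_inj hS h (t := t) (x ^ k • e) (by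
        change (x ^ k • e).comp (Ext.mk₀ (x • 𝟙 N)) (add_zero _) = 0
        rw [Ext.mk₀_smul, Ext.comp_smul, Ext.comp_mk₀_id, smul_smul, ← pow_succ', he])
      rw [Ext.comp_smul] at hs
      obtain ⟨w, h2, hw⟩ := ih s _ hs
      exact ⟨w, h1.trans h2, by rw [← pr_pr h1 h2, hw]⟩
  intro t e
  exact key t t e (tors hx e)

variable (a) in
/-- torsion -/
def IsTors (N : Type u) [AddCommGroup N] [Module R N] : Prop :=
  ∀ n : N, ∃ k : ℕ, ∀ r ∈ a ^ k, r • n = 0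

variable (a) in
/-- torsion part -/
def Gam (N : Type u) [AddCommGroup N] [Module R N] : Submodule R N where
  carrier := {n | ∃ k : ℕ, ∀ r ∈ a ^ k, r • n = 0}
  zero_mem' := ⟨0, by simp⟩
  add_mem' := by
    rintro x y ⟨k, hk⟩ ⟨l, hl⟩
    refine ⟨max k l, fun r hr => ?_⟩
    rw [smul_add, hk r (Ideal.pow_le_pow_right (le_max_left _ _) hr),
      hl r (Ideal.pow_le_pow_right (le_max_right _ _) hr), add_zero]
  smul_mem' := by
    rintro c x ⟨k, hk⟩
    exact ⟨k, fun r hr => by rw [smul_comm, hk r hr, smul_zero]⟩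

theorem gam_tors (N : Type u) [AddCommGroup N] [Module R N] : IsTors a (Gam a N) := by
  rintro ⟨n, k, hk⟩
  exact ⟨k, fun r hr => Subtype.ext (hk r hr)⟩

theorem tors_bound {B N : Type u} [AddCommGroup B] [Module R B] [Module.Finite R B]
    [AddCommGroup N] [Module R N] (hN : IsTors a N) (g : B →ₗ[R] N) :
    ∃ k : ℕ, ∀ r ∈ a ^ k, ∀ b, r • g b = 0 := by
  obtain ⟨s, hs⟩ := Module.Finite.fg_top (R := R) (M := B)
  choose k hk using hN
  refine ⟨s.sup (fun b => k (g b)), fun r hr b => ?_⟩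
  have hb : b ∈ Submodule.span R (s : Set B) := hs ▸ Submodule.mem_top
  induction hb using Submodule.span_induction with
  | mem x hx =>
    exact hk _ r (Ideal.pow_le_pow_right (Finset.le_sup (f := fun b => k (g b)) hx) hr)
  | zero => simp
  | add x y _ _ h1 h2 => rw [map_add, smul_add, h1, h2, add_zero]
  | smul c x _ h => rw [map_smul, smul_comm, h, smul_zero]

theorem gam_baer [IsNoetherianRing R] (I : Type u) [AddCommGroup I] [Module R I]
    (hI : Module.Injective R I) : Module.Baer R (Gam a I) := by
  intro b g
  obtain ⟨k, hk⟩ := tors_bound (gam_tors (a := a) I) g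
  obtain ⟨k0, hk0⟩ := Ideal.exists_pow_inf_eq_pow_smul a b
  have hAR : a ^ (k + k0) ⊓ b ≤ a ^ k • b := by
    have := hk0 (k + k0) (by omega)
    simp only [smul_eq_mul, Ideal.mul_top, Nat.add_sub_cancel] at this
    rw [this]
    exact Ideal.mul_mono_right inf_le_right
  have hker : ∀ y (hy : y ∈ b), y ∈ a ^ (k + k0) → g ⟨y, hy⟩ = 0 := by
    intro y hy hya
    have hy' := hAR ⟨hya, hy⟩
    have : ∀ z ∈ a ^ k • b, ∃ hz : z ∈ b, g ⟨z, hz⟩ = 0 := by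
      intro z hz
      induction hz using Submodule.smul_induction_on' with
      | smul r hr n hn =>
        refine ⟨b.mul_mem_left _ hn, ?_⟩
        have := hk r hr ⟨n, hn⟩
        rw [← map_smul] at this
        exact this
      | add x hx y hy h1 h2 =>
        obtain ⟨p1, q1⟩ := h1
        obtain ⟨p2, q2⟩ := h2
        refine ⟨b.add_mem p1 p2, ?_⟩
        have : g (⟨x, p1⟩ + ⟨y, p2⟩) = 0 := by rw [map_add, q1, q2, add_zero]
        exact this
    exact (this y hy').2
  let b' : Submodule R b := Submodule.comap (Submodule.subtype b) (a ^ (k + k0))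
  let ι : (b ⧸ b') →ₗ[R] (R ⧸ a ^ (k + k0)) := b'.mapQ (a ^ (k + k0)) (Submodule.subtype b) le_rfl
  have hι : Function.Injective ι := by
    rw [← LinearMap.ker_eq_bot, Submodule.eq_bot_iff]
    intro z hz
    obtain ⟨z, rfl⟩ := Submodule.Quotient.mk_surjective _ z
    rw [LinearMap.mem_ker, Submodule.mapQ_apply, Submodule.Quotient.mk_eq_zero] at hz
    rw [Submodule.Quotient.mk_eq_zero]
    exact hz
  let γ : (b ⧸ b') →ₗ[R] I := b'.liftQ ((Gam a I).subtype ∘ₗ g) (by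
    rintro ⟨y, hy⟩ hyb
    rw [LinearMap.mem_ker, LinearMap.comp_apply, hker y hy hyb, map_zero])
  obtain ⟨h, hh⟩ := hI.out ι hι γ
  refine ⟨LinearMap.codRestrict (Gam a I) (h ∘ₗ Submodule.mkQ _) ?_, ?_⟩
  · intro c
    refine ⟨k + k0, fun r hr => ?_⟩
    rw [← map_smul, LinearMap.comp_apply, Submodule.mkQ_apply, smul_eq_mul,
      (Submodule.Quotient.mk_eq_zero _).2 (Ideal.mul_mem_right _ _ hr), map_zero]
  · intro y hy
    apply Subtype.ext
    exact hh (Submodule.Quotient.mk ⟨y, hy⟩)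

theorem tors_ses [IsNoetherianRing R] (N : ModuleCat.{u} R) (hN : IsTors a N) :
    ∃ (J C : ModuleCat.{u} R) (f : N ⟶ J) (g : J ⟶ C) (w : f ≫ g = 0), Injective J ∧
      IsTors a J ∧ IsTors a C ∧ (ShortComplex.mk f g w).ShortExact := by
  let I := Injective.under N
  have hI : Module.Injective R I := by
    have hi : CategoryTheory.Injective I := inferInstance
    exact (Module.injective_iff_injective_object R I).2 hi
  let J : ModuleCat.{u} R := ModuleCat.of R (Gam a I)
  have hJ : Injective J := by
    have := (gam_baer (a := a) I hI).injective
    exact Module.injective_object_of_injective_module R _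
  let f0 : N →ₗ[R] Gam a I := LinearMap.codRestrict _ (Injective.ι N).hom (by
    intro n
    obtain ⟨k, hk⟩ := hN n
    exact ⟨k, fun r hr => by rw [← map_smul, hk r hr, map_zero]⟩)
  have hf0 : Function.Injective f0 := by
    have := (ModuleCat.mono_iff_injective (Injective.ι N)).1 inferInstance
    intro x y hxy
    exact this (congrArg Subtype.val hxy)
  refine ⟨J, ModuleCat.of R (Gam a I ⧸ LinearMap.range f0), ModuleCat.ofHom f0,
    ModuleCat.ofHom (Submodule.mkQ _), ?_, hJ, gam_tors _, ?_, ?_⟩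
  · ext x
    exact (Submodule.Quotient.mk_eq_zero _).2 ⟨x, rfl⟩
  · intro c
    obtain ⟨c, rfl⟩ := Submodule.Quotient.mk_surjective _ c
    obtain ⟨k, hk⟩ := gam_tors (a := a) I c
    exact ⟨k, fun r hr => by rw [← Submodule.Quotient.mk_smul, hk r hr]; rfl⟩
  · refine { exact := ?_, mono_f := (ModuleCat.mono_iff_injective _).2 hf0, epi_g := (ModuleCat.epi_iff_surjective _).2 (Submodule.mkQ_surjective _) }
    rw [ShortComplex.moduleCat_exact_iff]
    intro x hx
    exact (Submodule.Quotient.mk_eq_zero _).1 hx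

theorem van_tors [IsNoetherianRing R] (i : ℕ) : ∀ (N : ModuleCat.{u} R), IsTors a N →
    Van a (i+1) N := by
  induction i with
  | zero =>
    intro N hN t e
    obtain ⟨J, C, f, g, w, hJ, tJ, tC, hS⟩ := tors_ses N hN
    obtain ⟨x, rfl⟩ := Ext.covariant_sequence_exact₁ _ hS e (Ext.eq_zero_of_injective _)
      (n₀ := 0) rfl
    obtain ⟨c, rfl⟩ := Ext.addEquiv₀.symm.surjective x
    change Q a t ⟶ C at c
    obtain ⟨j, hj⟩ := hS.moduleCat_surjective_g (c (Submodule.Quotient.mk 1))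
    change g j = _ at hj
    obtain ⟨k, hk⟩ := tJ j
    have hs : a ^ (max t k) ≤ LinearMap.ker (LinearMap.toSpanSingleton R J j) := fun r hr =>
      hk r (Ideal.pow_le_pow_right (le_max_right _ _) hr)
    let j' : Q a (max t k) ⟶ J := ModuleCat.ofHom (Submodule.liftQ _ _ hs)
    have hcomm : pr a (le_max_left t k) ≫ c = j' ≫ g := by
      ext
      change c (Submodule.Quotient.mk 1) = g ((1 : R) • j)
      rw [one_smul, hj]
    refine ⟨max t k, le_max_left _ _, ?_⟩
    change (Ext.mk₀ _).comp ((Ext.mk₀ c).comp hS.extClass _) _ = 0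
    rw [Ext.mk₀_comp_mk₀_assoc, hcomm, ← Ext.mk₀_comp_mk₀_assoc]
    have := hS.comp_extClass
    change (Ext.mk₀ g).comp hS.extClass (zero_add 1) = 0 at this
    rw [this, Ext.comp_zero]
  | succ i ih =>
    intro N hN t e
    obtain ⟨J, C, f, g, w, hJ, tJ, tC, hS⟩ := tors_ses N hN
    exact van_inj hS (ih C tC) e (Ext.eq_zero_of_injective _)

theorem van_fg [IsNoetherianRing R] (Z : Set (PrimeSpectrum R)) (r : ℕ)
    (hZ : ∀ p ∈ Z, Van a r (ModuleCat.of R (R ⧸ p.asIdeal)))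
    (N : Type u) [AddCommGroup N] [Module R N] [hN : Module.Finite R N]
    (hs : Module.support R N ⊆ Z) : Van a r (ModuleCat.of R N) := by
  revert hs
  induction hN using IsNoetherianRing.induction_on_isQuotientEquivQuotientPrime R with
  | subsingleton N => intro _; exact van_sub
  | quotient N p φ =>
    intro hs
    refine van_iso φ.symm.toModuleIso (hZ p (hs ?_))
    rw [φ.support_eq, Module.support_eq_zeroLocus, Ideal.annihilator_quotient]
    exact Set.Subset.refl _
  | exact N₁ N₂ N₃ f g hf hg hfg h1 h3 =>
    intro hs
    rw [Module.support_of_exact hfg hf hg] at hs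
    have hS : (ShortComplex.mk (ModuleCat.ofHom f) (ModuleCat.ofHom g)
      (by ext x; exact hfg.apply_apply_eq_zero x)).ShortExact :=
      { exact := by
          rw [ShortComplex.moduleCat_exact_iff]
          intro x hx
          exact (hfg x).1 hx
        mono_f := (ModuleCat.mono_iff_injective _).2 hf
        epi_g := (ModuleCat.epi_iff_surjective _).2 hg }
    exact van_mid hS (h1 (Set.subset_union_left.trans hs)) (h3 (Set.subset_union_right.trans hs))

theorem van_step [IsNoetherianRing R] (M : Type u) [AddCommGroup M] [Module R M] (r : ℕ)
    (hZ : ∀ p ∈ Module.support R M, Van a r (ModuleCat.of R (R ⧸ p.asIdeal))) :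
    ∀ p ∈ Module.support R M, Van a (r+1) (ModuleCat.of R (R ⧸ p.asIdeal)) := by
  intro p hp
  by_cases hap : a ≤ p.asIdeal
  · refine van_tors r _ fun n => ⟨1, fun x hx => ?_⟩
    rw [pow_one] at hx
    obtain ⟨n, rfl⟩ := Submodule.Quotient.mk_surjective _ n
    rw [← Submodule.Quotient.mk_smul, Submodule.Quotient.mk_eq_zero]
    exact Ideal.mul_mem_right _ _ (hap hx)
  · obtain ⟨x, hxa, hxp⟩ := SetLike.not_le_iff_exists.1 hap
    let N := R ⧸ p.asIdeal
    let m : N →ₗ[R] N := x • LinearMap.id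
    have hm : Function.Injective m := by
      rw [← LinearMap.ker_eq_bot, Submodule.eq_bot_iff]
      intro z hz
      obtain ⟨z, rfl⟩ := Submodule.Quotient.mk_surjective _ z
      change x • (Submodule.Quotient.mk z : R ⧸ p.asIdeal) = 0 at hz
      rw [← Submodule.Quotient.mk_smul, Submodule.Quotient.mk_eq_zero] at hz
      exact (Submodule.Quotient.mk_eq_zero _).2 ((p.isPrime.mem_or_mem hz).resolve_left hxp)
    have hsup : Module.support R (N ⧸ LinearMap.range m) ⊆ Module.support R M := by
      refine (Module.support_subset_of_surjective (Submodule.mkQ (LinearMap.range m))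
        (Submodule.mkQ_surjective _)).trans ?_
      intro q hq
      rw [Module.support_eq_zeroLocus, Ideal.annihilator_quotient] at hq
      exact Module.mem_support_mono (show p ≤ q from hq) hp
    have hV := van_fg (a := a) _ r hZ (N ⧸ LinearMap.range m) hsup
    refine van_x hxa (ModuleCat.ofHom (Submodule.mkQ (LinearMap.range m))) ?_ ?_ hV
    · ext z
      exact (Submodule.Quotient.mk_eq_zero _).2 ⟨_, rfl⟩
    · refine { exact := ?_, mono_f := (ModuleCat.mono_iff_injective _).2 hm, epi_g := (ModuleCat.epi_iff_surjective _).2 (Submodule.mkQ_surjective _) }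
      rw [ShortComplex.moduleCat_exact_iff]
      intro y hy
      exact (Submodule.Quotient.mk_eq_zero _).1 hy
end


end

theorem stmt13 (R : Type u) [CommRing R] [IsNoetherianRing R]
    (a : Ideal R) (ha : a ≠ ⊤) (r : ℕ)
    (M : Type u) [AddCommGroup M] [Module R M] [Module.Finite R M]
    (hvan : ∀ p ∈ Module.support R M, Subsingleton (LC a r (R ⧸ p.asIdeal))) :
    (∀ p ∈ Module.support R M, ∀ i : ℕ, r ≤ i →
        Subsingleton (LC a i (R ⧸ p.asIdeal))) ∧
      (∀ i : ℕ, r ≤ i → Subsingleton (LC a i M)) ∧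
      cohDim R a M < (r : ℕ∞) := by
  have h1 : ∀ i : ℕ, r ≤ i → ∀ p ∈ Module.support R M,
      Van a i (ModuleCat.of R (R ⧸ p.asIdeal)) := by
    intro i hi
    induction i, hi using Nat.le_induction with
    | base => exact fun p hp => (lc_iff a r _).1 (hvan p hp)
    | succ i _ ih => exact van_step M i ih
  have h2 : ∀ i : ℕ, r ≤ i → Subsingleton (LC a i M) := fun i hi =>
    (lc_iff a i M).2 (van_fg _ i (h1 i hi) M subset_rfl)
  refine ⟨fun p hp i hi => (lc_iff a i _).2 (h1 i hi p hp), h2, ?_⟩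
  have hlt : ∀ i : ℕ, Nontrivial (LC a i M) → i < r := by
    intro i hn
    by_contra hc
    exact not_subsingleton_iff_nontrivial.2 hn (h2 i (not_lt.1 hc))
  unfold cohDim
  rcases r with _ | r
  · have : {x : WithBot ℕ∞ | ∃ i : ℕ, x = (i : ℕ∞) ∧ Nontrivial (LC a i M)} = ∅ := by
      ext x
      simp only [Set.mem_setOf_eq, Set.mem_empty_iff_false, iff_false]
      rintro ⟨i, _, hn⟩
      exact absurd (hlt i hn) (Nat.not_lt_zero _)
    rw [this, sSup_empty]
    exact WithBot.bot_lt_coe _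
  · refine lt_of_le_of_lt (b := (((r : ℕ) : ℕ∞) : WithBot ℕ∞)) (sSup_le ?_) ?_
    · rintro x ⟨i, rfl, hn⟩
      exact WithBot.coe_le_coe.2 (Nat.cast_le.2 (Nat.lt_succ_iff.1 (hlt i hn)))
    · exact WithBot.coe_lt_coe.2 (Nat.cast_lt.2 (Nat.lt_succ_self r))

end
end

section
/- Let R be a commutative Noetherian ring, a an ideal, and M a finitely generated R-module. For each integer i with 0 ≤ i ≤ cd(a, M), there exists p ∈ Supp(M) with H_a^i(R/p) ≠ 0. -/
noncomputable section

universe u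

open CategoryTheory

namespace LCAux
open Opposite CategoryTheory.Limits CategoryTheory.Abelian

variable {R : Type u} [CommRing R]

/-- The complex (in the opposite category) of homs from a resolution into `Y`. -/
abbrev KK {X : ModuleCat.{u} R} (P : ProjectiveResolution X) (Y : ModuleCat.{u} R) :
    ChainComplex (ModuleCat.{u} R)ᵒᵖ ℕ :=
  ((((linearYoneda R (ModuleCat.{u} R)).obj Y).rightOp).mapHomologicalComplex _).obj P.complex

/-- Comparison isomorphism. -/
def isoH {X : ModuleCat.{u} R} (P : ProjectiveResolution X) (Y : ModuleCat.{u} R) (n : ℕ) :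
    (((linearYoneda R (ModuleCat.{u} R)).obj Y).rightOp.leftDerived n).obj X ≅
      (KK P Y).homology n :=
  P.isoLeftDerivedObj ((linearYoneda R (ModuleCat.{u} R)).obj Y).rightOp n

/-- cocycles to `Ext`. -/
def cls {X : ModuleCat.{u} R} (P : ProjectiveResolution X) (Y : ModuleCat.{u} R) (n : ℕ) :
    ((KK P Y).opcycles n).unop ⟶ ((_root_.Ext R (ModuleCat.{u} R) n).obj (op X)).obj Y :=
  ((KK P Y).homologyι n).unop ≫
    (isoH P Y n).hom.unop

/-- underlying map of a cocycle. -/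
def inc {X : ModuleCat.{u} R} (P : ProjectiveResolution X) (Y : ModuleCat.{u} R) (n : ℕ) :
    ((KK P Y).opcycles n).unop ⟶ ModuleCat.of R (P.complex.X n ⟶ Y) :=
  ((KK P Y).pOpcycles n).unop

lemma cls_surj {X : ModuleCat.{u} R} (P : ProjectiveResolution X) (Y : ModuleCat.{u} R) (n : ℕ) :
    Function.Surjective (cls P Y n) := by
  rw [← ModuleCat.epi_iff_surjective]
  have h1 : Epi ((KK P Y).homologyι n).unop := unop_epi_of_mono _
  have h2 : Epi (isoH P Y n).hom.unop := unop_epi_of_mono _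
  exact epi_comp' h1 h2

lemma inc_inj {X : ModuleCat.{u} R} (P : ProjectiveResolution X) (Y : ModuleCat.{u} R) (n : ℕ) :
    Function.Injective (inc P Y n) := by
  rw [← ModuleCat.mono_iff_injective]
  exact unop_mono_of_epi ((KK P Y).pOpcycles n)

lemma inc_cocycle {X : ModuleCat.{u} R} (P : ProjectiveResolution X) (Y : ModuleCat.{u} R)
    (n m : ℕ) (z : ((KK P Y).opcycles n).unop) :
    P.complex.d m n ≫ (show P.complex.X n ⟶ Y from inc P Y n z) = 0 := by
  have h := congrArg Quiver.Hom.unop ((KK P Y).d_pOpcycles m n)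
  exact congrArg (fun f => f.hom z) h

lemma inc_surj {X : ModuleCat.{u} R} (P : ProjectiveResolution X) (Y : ModuleCat.{u} R)
    (n : ℕ) (f : P.complex.X n ⟶ Y) (hf : P.complex.d (n+1) n ≫ f = 0) :
    ∃ z, inc P Y n z = f := by
  let k : ModuleCat.of R R ⟶ ModuleCat.of R (P.complex.X n ⟶ Y) :=
    ModuleCat.ofHom (LinearMap.toSpanSingleton R _ f)
  let k' : (KK P Y).X n ⟶ op (ModuleCat.of R R) := k.op
  have hk : (KK P Y).d (n+1) n ≫ k' = 0 := by
    apply Quiver.Hom.unop_inj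
    refine ModuleCat.hom_ext (LinearMap.ext_ring ?_)
    refine Eq.trans (b := P.complex.d (n+1) n ≫ ((1:R) • f)) rfl ?_
    rw [one_smul, hf]
    rfl
  have h := congrArg Quiver.Hom.unop ((KK P Y).p_descOpcycles k' (n+1) (by simp) hk)
  refine ⟨((KK P Y).descOpcycles k' (n+1) (by simp) hk).unop (1:R), ?_⟩
  have h2 := congrArg (fun f => f.hom (1:R)) h
  refine Eq.trans h2 ?_
  exact one_smul R f

lemma cls_zero_iff {X : ModuleCat.{u} R} (P : ProjectiveResolution X) (Y : ModuleCat.{u} R)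
    (n : ℕ) (z : ((KK P Y).opcycles n).unop) :
    cls P Y n z = 0 ↔ ∃ g : P.complex.X ((ComplexShape.down ℕ).next n) ⟶ Y,
      P.complex.d n _ ≫ g = inc P Y n z := by
  let S : ShortComplex (ModuleCat.{u} R)ᵒᵖ := ShortComplex.mk ((KK P Y).homologyι n)
    ((KK P Y).fromOpcycles n ((ComplexShape.down ℕ).next n))
    ((KK P Y).homologyι_comp_fromOpcycles n _)
  have hS : S.Exact := ShortComplex.exact_of_f_is_kernel S
    ((KK P Y).homologyIsKernel n _ rfl)
  have hS' := (ShortComplex.ShortExact.moduleCat_exact_iff_function_exact S.unop).1 hS.unop z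
  have h0 : cls P Y n z = 0 ↔ S.unop.g z = 0 := by
    have h2 : Mono (isoH P Y n).hom.unop := unop_mono_of_epi _
    have h2' := (ModuleCat.mono_iff_injective _).1 h2
    refine Iff.trans ?_ (map_eq_zero_iff (isoH P Y n).hom.unop.hom h2')
    rfl
  rw [h0]
  refine Iff.trans hS' ?_
  constructor
  · rintro ⟨g, hg⟩
    refine ⟨g, ?_⟩
    have h := congrArg (fun f => f.unop.hom g) ((KK P Y).p_fromOpcycles n
      ((ComplexShape.down ℕ).next n))
    rw [← hg]
    exact h.symm
  · rintro ⟨g, hg⟩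
    refine ⟨g, ?_⟩
    have h := congrArg (fun f => f.unop.hom g) ((KK P Y).p_fromOpcycles n
      ((ComplexShape.down ℕ).next n))
    apply inc_inj P Y n
    exact Eq.trans h hg

lemma cls_nat {X X' : ModuleCat.{u} R} {P : ProjectiveResolution X} {P' : ProjectiveResolution X'}
    {g : X' ⟶ X} (φ : ProjectiveResolution.Hom P' P g) (Y : ModuleCat.{u} R)
    (n : ℕ) (z : ((KK P Y).opcycles n).unop) :
    ∃ z' : ((KK P' Y).opcycles n).unop,
      cls P' Y n z' = (((_root_.Ext R (ModuleCat.{u} R) n).map g.op).app Y) (cls P Y n z) ∧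
      inc P' Y n z' = φ.hom.f n ≫ (show P.complex.X n ⟶ Y from inc P Y n z) := by
  let F := ((linearYoneda R (ModuleCat.{u} R)).obj Y).rightOp
  let ψ : KK P' Y ⟶ KK P Y := (F.mapHomologicalComplex _).map φ.hom
  refine ⟨(HomologicalComplex.opcyclesMap ψ n).unop z, ?_, ?_⟩
  · have h1 : (F.leftDerived n).map g ≫ (isoH P Y n).hom = (isoH P' Y n).hom ≫
        HomologicalComplex.homologyMap ψ n :=
      ProjectiveResolution.isoLeftDerivedObj_hom_naturality g P' P φ.hom
        φ.hom_f_zero_comp_π_f_zero F n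
    have h2 := HomologicalComplex.homologyι_naturality ψ n
    have h3 : (F.leftDerived n).map g ≫ (isoH P Y n).hom ≫ (KK P Y).homologyι n =
      (isoH P' Y n).hom ≫ (KK P' Y).homologyι n ≫ HomologicalComplex.opcyclesMap ψ n := by
      rw [← h2, reassoc_of% h1]
    have h4 := congrArg (fun f => f.unop.hom z) h3
    exact h4.symm
  · have h := congrArg (fun f => f.unop.hom z) (HomologicalComplex.p_opcyclesMap ψ n)
    exact h

lemma extMk_zero_iff {X : ModuleCat.{u} R} (P : ProjectiveResolution X) (Y : ModuleCat.{u} R)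
    (n : ℕ) (f : P.complex.X n ⟶ Y) (hf : P.complex.d (n+1) n ≫ f = 0) :
    P.extMk f (n+1) rfl hf = 0 ↔ ∃ g : P.complex.X ((ComplexShape.down ℕ).next n) ⟶ Y,
      P.complex.d n _ ≫ g = f := by
  rcases n with _ | n
  · have hz : IsZero (P.cochainComplex.X 1) := P.cochainComplex.isZero_of_isStrictlyLE 0 1
    simp only [← P.extEquivCohomologyClass.apply_eq_iff_eq,
      ProjectiveResolution.extEquivCohomologyClass_extMk,
      ProjectiveResolution.extEquivCohomologyClass_zero,
      CochainComplex.HomComplex.CohomologyClass.mk_eq_zero_iff]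
    rw [CochainComplex.HomComplex.Cocycle.toSingleMk_mem_coboundaries_iff _ _ _ _ _ 1 (by simp)]
    have h0 : P.complex.d 0 ((ComplexShape.down ℕ).next 0) = 0 := by
      apply P.complex.shape; simp
    rw [h0]
    constructor
    · rintro ⟨g, hg⟩
      refine ⟨0, ?_⟩
      rw [hz.eq_of_src g 0, comp_zero] at hg
      rw [← cancel_epi (P.cochainComplexXIso (-(0:ℕ)) 0 rfl).hom, ← hg]
      simp
    · rintro ⟨g, hg⟩
      refine ⟨0, ?_⟩
      rw [← hg]
      simp
  · have h : (ComplexShape.down ℕ).next (n+1) = n := by simp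
    rw [h]
    exact P.extMk_eq_zero_iff f _ rfl hf n rfl

/-- Relation comparing the two models of `Ext`. -/
def Rel (X Y : ModuleCat.{u} R) (n : ℕ)
    (x : ((_root_.Ext R (ModuleCat.{u} R) n).obj (op X)).obj Y) (y : Abelian.Ext.{u} X Y n) : Prop :=
  ∃ z : ((KK (projectiveResolution X) Y).opcycles n).unop,
    cls (projectiveResolution X) Y n z = x ∧
    (projectiveResolution X).extMk (inc (projectiveResolution X) Y n z) (n+1) rfl
      (inc_cocycle _ Y n _ z) = y

lemma Rel.left (X Y : ModuleCat.{u} R) (n : ℕ) (x) : ∃ y, Rel X Y n x y := by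
  obtain ⟨z, hz⟩ := cls_surj (projectiveResolution X) Y n x
  exact ⟨_, z, hz, rfl⟩

lemma Rel.right (X Y : ModuleCat.{u} R) (n : ℕ) (y) : ∃ x, Rel X Y n x y := by
  obtain ⟨f, hf, rfl⟩ := (projectiveResolution X).extMk_surjective y (n+1) rfl
  obtain ⟨z, rfl⟩ := inc_surj _ Y n f hf
  exact ⟨_, z, rfl, rfl⟩

lemma Rel.zero_iff {X Y : ModuleCat.{u} R} {n : ℕ} {x y} (h : Rel X Y n x y) : x = 0 ↔ y = 0 := by
  obtain ⟨z, rfl, rfl⟩ := h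
  rw [extMk_zero_iff]
  exact cls_zero_iff _ Y n z

lemma Rel.map {X X' Y : ModuleCat.{u} R} {n : ℕ} {x y} (h : Rel X Y n x y) (g : X' ⟶ X) :
    Rel X' Y n (((_root_.Ext R (ModuleCat.{u} R) n).map g.op).app Y x)
      ((Abelian.Ext.mk₀ g).comp y (zero_add n)) := by
  obtain ⟨z, rfl, rfl⟩ := h
  let φ : ProjectiveResolution.Hom (projectiveResolution X') (projectiveResolution X) g :=
    ⟨ProjectiveResolution.lift g _ _, ProjectiveResolution.lift_commutes_zero g _ _⟩
  obtain ⟨z', h1, h2⟩ := cls_nat φ Y n z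
  refine ⟨z', h1, ?_⟩
  rw [ProjectiveResolution.mk₀_comp_extMk _ _ _ _ φ]
  congr 1

/-- The projection `R/a^s → R/a^t`. -/
abbrev pr (a : Ideal R) {t s : ℕ} (h : t ≤ s) :
    ModuleCat.of R (R ⧸ a ^ s) ⟶ ModuleCat.of R (R ⧸ a ^ t) :=
  ModuleCat.ofHom (Submodule.mapQ _ _ LinearMap.id (Ideal.pow_le_pow_right h))

/-- Every class dies in the direct limit. -/
def Dies (a : Ideal R) (n : ℕ) (N : ModuleCat.{u} R) : Prop :=
  ∀ (t : ℕ) (x : Abelian.Ext.{u} (ModuleCat.of R (R ⧸ a ^ t)) N n),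
    ∃ (s : ℕ) (h : t ≤ s), (Abelian.Ext.mk₀ (pr a h)).comp x (zero_add n) = 0

lemma subsingleton_iff_dies (a : Ideal R) (n : ℕ) (N : ModuleCat.{u} R) :
    Subsingleton ((localCohomology a n).obj N) ↔ Dies a n N := by
  let D := localCohomology.diagram (localCohomology.idealPowersDiagram a) n
  let G := D ⋙ (evaluation _ _).obj N
  let e : (localCohomology a n).obj N ≅ colimit G := colimitObjIsoColimitCompEvaluation D N
  have hG (t s : ℕ) (h : t ≤ s) (x y)
     (hr : Rel (ModuleCat.of R (R ⧸ a ^ t)) N n x y) :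
    (G.map (homOfLE h).op.op (show G.obj (op (op t)) from x) = 0) ↔
      (Abelian.Ext.mk₀ (pr a h)).comp y (zero_add n) = 0 :=
    (hr.map (pr a h)).zero_iff
  have hp : PreservesFilteredColimitsOfSize.{0, 0} (forget (ModuleCat.{u} R)) :=
    preservesFilteredColimitsOfSize_shrink.{0, u, 0, u} _
  have hp' : PreservesColimitsOfShape (ℕᵒᵖᵒᵖ) (forget (ModuleCat.{u} R)) :=
    hp.preserves_filtered_colimits _
  have key : Subsingleton (colimit G : ModuleCat.{u} R) ↔ Dies a n N := by
    constructor
    · intro hs t y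
      obtain ⟨x, hx⟩ := Rel.right _ N n y
      obtain ⟨j, i, h⟩ := Concrete.colimit_rep_eq_zero (F := G) (j := op (op t)) (x := x)
        (hx := Subsingleton.elim _ _)
      exact ⟨j.unop.unop, leOfHom i.unop.unop, (hG _ _ _ _ _ hx).1 h⟩
    · intro hd
      refine ⟨fun u v => ?_⟩
      have : ∀ u : (colimit G : ModuleCat.{u} R), u = 0 := by
        intro u
        obtain ⟨j, x, rfl⟩ := Concrete.colimit_exists_rep G u
        obtain ⟨y, hy⟩ := Rel.left _ N n x
        obtain ⟨s, h, hs⟩ := hd j.unop.unop y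
        have h1 := (hG _ _ h _ _ hy).2 hs
        have h2 := congrArg (fun f => f.hom x) (colimit.w G (homOfLE h).op.op)
        refine h2.symm.trans ?_
        exact (congrArg (colimit.ι G _).hom h1).trans (map_zero _)
      rw [this u, this v]
  rw [← key]
  exact e.toLinearEquiv.toEquiv.subsingleton_congr

lemma pr_comp (a : Ideal R) {t s r : ℕ} (h : t ≤ s) (h' : s ≤ r) :
    pr a h' ≫ pr a h = pr a (h.trans h') := by
  refine ModuleCat.hom_ext (Submodule.linearMap_qext _ ?_)
  ext
  rfl

lemma die_comp {a : Ideal R} {n : ℕ} {N : ModuleCat.{u} R} {t s : ℕ} (h : t ≤ s)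
    (x : Abelian.Ext.{u} (ModuleCat.of R (R ⧸ a ^ t)) N n)
    (hd : ∃ (r : ℕ) (h' : s ≤ r), (Abelian.Ext.mk₀ (pr a h')).comp
      ((Abelian.Ext.mk₀ (pr a h)).comp x (zero_add n)) (zero_add n) = 0) :
    ∃ (s : ℕ) (h : t ≤ s), (Abelian.Ext.mk₀ (pr a h)).comp x (zero_add n) = 0 := by
  obtain ⟨r, h', hr⟩ := hd
  refine ⟨r, h.trans h', ?_⟩
  rw [← hr, Abelian.Ext.mk₀_comp_mk₀_assoc, pr_comp]

lemma Dies.mid {a : Ideal R} {n : ℕ} {S : ShortComplex (ModuleCat.{u} R)} (hS : S.ShortExact)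
    (h1 : Dies a n S.X₁) (h3 : Dies a n S.X₃) : Dies a n S.X₂ := by
  intro t x
  obtain ⟨s, h, hs⟩ := h3 t (x.comp (Abelian.Ext.mk₀ S.g) (add_zero n))
  apply die_comp h
  rw [← Abelian.Ext.comp_assoc_of_third_deg_zero] at hs
  obtain ⟨y, hy⟩ := Abelian.Ext.covariant_sequence_exact₂ _ hS _ hs
  obtain ⟨r, h', hr⟩ := h1 s y
  refine ⟨r, h', ?_⟩
  rw [← hy, ← Abelian.Ext.comp_assoc_of_third_deg_zero, hr, Abelian.Ext.zero_comp]

lemma Dies.iso {a : Ideal R} {n : ℕ} {N N' : ModuleCat.{u} R} (e : N ≅ N')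
    (h : Dies a n N) : Dies a n N' :=
  (subsingleton_iff_dies a n N').1
    (((localCohomology a n).mapIso e).toLinearEquiv.toEquiv.subsingleton_congr.1
      ((subsingleton_iff_dies a n N).2 h))

lemma dies_of_subsingleton {a : Ideal R} {n : ℕ} {N : ModuleCat.{u} R} [Subsingleton N] :
    Dies a n N := by
  intro t x
  have : Abelian.Ext.mk₀ (𝟙 N) = 0 := by
    rw [(ModuleCat.isZero_of_subsingleton N).eq_of_src (𝟙 N) 0, Abelian.Ext.mk₀_zero]
  refine ⟨t, le_rfl, ?_⟩
  rw [← Abelian.Ext.comp_mk₀_id x, this]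
  simp

lemma dies_of_primes [IsNoetherianRing R] {a : Ideal R} {n : ℕ} (Z : Set (PrimeSpectrum R))
    (h : ∀ p ∈ Z, Dies a n (ModuleCat.of R (R ⧸ p.asIdeal)))
    (N : Type u) [AddCommGroup N] [Module R N] [hN : Module.Finite R N]
    (hZ : Module.support R N ⊆ Z) : Dies a n (ModuleCat.of R N) := by
  revert hZ
  induction hN using IsNoetherianRing.induction_on_isQuotientEquivQuotientPrime R with
  | subsingleton N => intro _; exact dies_of_subsingleton
  | quotient N p e =>
    intro hZ
    refine Dies.iso e.symm.toModuleIso (h p (hZ ?_))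
    rw [e.support_eq, Module.support_eq_zeroLocus, Ideal.annihilator_quotient]
    exact (PrimeSpectrum.mem_zeroLocus _ _).2 (Set.Subset.refl _)
  | exact N₁ N₂ N₃ f g hf hg hfg h1 h3 =>
    intro hZ
    rw [Module.support_of_exact hfg hf hg] at hZ
    have hS : (ShortComplex.mk (ModuleCat.ofHom f) (ModuleCat.ofHom g)
      (by rw [← ModuleCat.ofHom_comp, hfg.linearMap_comp_eq_zero]; rfl)).ShortExact :=
      { exact := (ShortComplex.ShortExact.moduleCat_exact_iff_function_exact _).2 hfg
        mono_f := (ModuleCat.mono_iff_injective _).2 hf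
        epi_g := (ModuleCat.epi_iff_surjective _).2 hg }
    exact Dies.mid hS (h1 (Set.subset_union_left.trans hZ)) (h3 (Set.subset_union_right.trans hZ))

/-- The regular-element step. -/
lemma dies_succ_of_reg {a : Ideal R} {n : ℕ} (N : Type u) [AddCommGroup N] [Module R N]
    (x : R) (hx : x ∈ a) (hreg : ∀ t : ℕ, IsSMulRegular N (x ^ t))
    (hq : ∀ t : ℕ, Dies a n (ModuleCat.of R (N ⧸ LinearMap.range (LinearMap.lsmul R N (x ^ t))))) :
    Dies a (n + 1) (ModuleCat.of R N) := by
  intro t y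
  let f := LinearMap.lsmul R N (x ^ t)
  let S : ShortComplex (ModuleCat.{u} R) := ShortComplex.mk (ModuleCat.ofHom f)
    (ModuleCat.ofHom (LinearMap.range f).mkQ)
    (by rw [← ModuleCat.ofHom_comp, LinearMap.range_mkQ_comp]; rfl)
  have hS : S.ShortExact :=
      { exact := (ShortComplex.ShortExact.moduleCat_exact_iff_function_exact _).2
          (LinearMap.exact_map_mkQ_range f)
        mono_f := (ModuleCat.mono_iff_injective _).2 (hreg t)
        epi_g := (ModuleCat.epi_iff_surjective _).2 (Submodule.mkQ_surjective _) }
  have h0 : y.comp (Abelian.Ext.mk₀ S.f) (add_zero _) = 0 := by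
    have e1 : S.f = (x ^ t) • 𝟙 (ModuleCat.of R N) := rfl
    have e2 : (x ^ t) • 𝟙 (ModuleCat.of R (R ⧸ a ^ t)) = 0 := by
      refine ModuleCat.hom_ext (Submodule.linearMap_qext _ ?_)
      ext
      change x ^ t • (Submodule.Quotient.mk 1 : R ⧸ a ^ t) = 0
      rw [← Submodule.Quotient.mk_smul, Submodule.Quotient.mk_eq_zero]
      simpa using Ideal.pow_mem_pow hx t
    rw [e1, Abelian.Ext.mk₀_smul, Abelian.Ext.comp_smul]
    have : (x ^ t) • (Abelian.Ext.mk₀ (𝟙 (ModuleCat.of R (R ⧸ a ^ t)))).comp y (zero_add _) = 0 := by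
      rw [← Abelian.Ext.smul_comp, ← Abelian.Ext.mk₀_smul, e2]
      simp
    rw [Abelian.Ext.mk₀_id_comp] at this
    rw [← this]
    congr 1
    exact Abelian.Ext.comp_mk₀_id y
  obtain ⟨z, rfl⟩ := Abelian.Ext.covariant_sequence_exact₁ _ hS y h0 rfl
  obtain ⟨s, h, hs⟩ := hq t t z
  refine ⟨s, h, ?_⟩
  rw [← Abelian.Ext.comp_assoc _ _ _ (zero_add n) rfl (by omega), hs, Abelian.Ext.zero_comp]

lemma shift {n : ℕ} {S : ShortComplex (ModuleCat.{u} R)} (hS : S.ShortExact) [Projective S.X₂]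
    {N : ModuleCat.{u} R} (x : Abelian.Ext.{u} S.X₃ N (n+1)) :
    ∃ η : Abelian.Ext.{u} S.X₁ N n, ∀ (S' : ShortComplex (ModuleCat.{u} R)) (_ : S'.ShortExact)
      (φ : S' ⟶ S), (Abelian.Ext.mk₀ φ.τ₁).comp η (zero_add n) = 0 →
        (Abelian.Ext.mk₀ φ.τ₃).comp x (zero_add _) = 0 := by
  obtain ⟨η, rfl⟩ := Abelian.Ext.contravariant_sequence_exact₃ hS N x
    (Abelian.Ext.eq_zero_of_projective _) (n₀ := n) (by omega)
  refine ⟨η, fun S' hS' φ h => ?_⟩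
  rw [← Abelian.Ext.comp_assoc _ _ _ (zero_add 1) (by omega) (by omega),
    ← ShortComplex.ShortExact.extClass_naturality hS' hS φ,
    Abelian.Ext.comp_assoc _ _ _ (add_zero 1) (zero_add n) (by omega), h, Abelian.Ext.comp_zero]

lemma mem_smul_top_sub {F : Type u} [AddCommGroup F] [Module R F] (I : Ideal R)
    (L : Submodule R F) (v : L) (hv : (v : F) ∈ I • L) : v ∈ (I • ⊤ : Submodule R L) := by
  have : Submodule.map L.subtype (I • ⊤ : Submodule R L) = I • L := by
    rw [Submodule.map_smul'', Submodule.map_top, Submodule.range_subtype]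
  rw [← this] at hv
  obtain ⟨w, hw, e⟩ := hv
  have : w = v := Subtype.ext e
  rwa [← this]

/-- The kernel sequence of a linear map. -/
abbrev kerSeq {A B : Type u} [AddCommGroup A] [AddCommGroup B] [Module R A] [Module R B]
    (π : A →ₗ[R] B) : ShortComplex (ModuleCat.{u} R) :=
  ShortComplex.mk (ModuleCat.ofHom (LinearMap.ker π).subtype)
      (ModuleCat.ofHom π) (by rw [← ModuleCat.ofHom_comp, LinearMap.comp_ker_subtype]; rfl)

lemma kerSeq_shortExact {A B : Type u} [AddCommGroup A] [AddCommGroup B] [Module R A]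
    [Module R B] (π : A →ₗ[R] B) (hπ : Function.Surjective π) : (kerSeq π).ShortExact :=
  { exact := (ShortComplex.ShortExact.moduleCat_exact_iff_function_exact _).2
          (LinearMap.exact_subtype_ker_map π)
    mono_f := (ModuleCat.mono_iff_injective _).2 (Submodule.injective_subtype _)
    epi_g := (ModuleCat.epi_iff_surjective _).2 hπ }

lemma kerSeq_map {A B A' B' : Type u} [AddCommGroup A] [AddCommGroup B] [AddCommGroup A']
    [AddCommGroup B'] [Module R A] [Module R B] [Module R A'] [Module R B']
    (π : A →ₗ[R] B) (π' : A' →ₗ[R] B') (i : A' →ₗ[R] A) (iB : B' →ₗ[R] B)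
    (h : ∀ v, π (i v) = iB (π' v)) (Q : Submodule R (LinearMap.ker π))
    (hQ : ∀ v, ∀ hv : i v ∈ LinearMap.ker π, (⟨i v, hv⟩ : LinearMap.ker π) ∈ Q) :
    ∃ φ : kerSeq π' ⟶ kerSeq π, φ.τ₃ = ModuleCat.ofHom iB ∧
      ∃ g : (kerSeq π').X₁ ⟶ ModuleCat.of R Q, φ.τ₁ = g ≫ ModuleCat.ofHom Q.subtype := by
  have hL : ∀ v : LinearMap.ker π', (i ∘ₗ (LinearMap.ker π').subtype) v ∈ LinearMap.ker π := by
    rintro ⟨v, hv⟩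
    have hv : π' v = 0 := hv
    change π (i v) = 0
    rw [h, hv, map_zero]
  let j : LinearMap.ker π' →ₗ[R] LinearMap.ker π :=
    LinearMap.codRestrict (LinearMap.ker π) (i ∘ₗ (LinearMap.ker π').subtype) hL
  have hj : ∀ v, j v ∈ Q := fun v => hQ v.1 (hL v)
  refine ⟨{ τ₁ := ModuleCat.ofHom j
            τ₂ := ModuleCat.ofHom i
            τ₃ := ModuleCat.ofHom iB
            comm₁₂ := rfl
            comm₂₃ := ?_ }, rfl, ModuleCat.ofHom (LinearMap.codRestrict Q j hj), rfl⟩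
  ext v
  exact h v

lemma pro_zero [IsNoetherianRing R] (a : Ideal R) (N : ModuleCat.{u} R)
    (hN : ∀ r ∈ a, ∀ m : N, r • m = 0) (n : ℕ) :
    ∀ (K : Type u) [AddCommGroup K] [Module R K] [Module.Finite R K]
      (x : Abelian.Ext.{u} (ModuleCat.of R K) N n),
      ∃ s : ℕ, (Abelian.Ext.mk₀ (ModuleCat.ofHom (a ^ s • ⊤ : Submodule R K).subtype)).comp x
        (zero_add n) = 0 := by
  induction n with
  | zero =>
    intro K _ _ _ x
    refine ⟨1, ?_⟩
    obtain ⟨f, rfl⟩ : ∃ f, Abelian.Ext.mk₀ f = x := ⟨_, Abelian.Ext.mk₀_addEquiv₀_apply x⟩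
    rw [Abelian.Ext.mk₀_comp_mk₀]
    have : (ModuleCat.ofHom (a ^ 1 • ⊤ : Submodule R K).subtype) ≫ f = 0 := by
      refine ModuleCat.hom_ext (LinearMap.ext ?_)
      rintro ⟨v, hv⟩
      change f.hom v = 0
      have hle : (a ^ 1 • ⊤ : Submodule R K) ≤ LinearMap.ker f.hom := by
        rw [Submodule.smul_le]
        intro r hr m _
        rw [LinearMap.mem_ker, map_smul]
        exact hN r (by simpa using hr) _
      exact hle hv
    rw [this, Abelian.Ext.mk₀_zero]
  | succ n ih =>
    intro K _ _ _ x
    obtain ⟨k, π, hπ⟩ := Module.Finite.exists_fin' R K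
    let L := LinearMap.ker π
    let S : ShortComplex (ModuleCat.{u} R) := ShortComplex.mk (ModuleCat.ofHom L.subtype)
      (ModuleCat.ofHom π) (by rw [← ModuleCat.ofHom_comp, LinearMap.comp_ker_subtype]; rfl)
    have hS : S.ShortExact :=
      { exact := (ShortComplex.ShortExact.moduleCat_exact_iff_function_exact _).2
          (LinearMap.exact_subtype_ker_map π)
        mono_f := (ModuleCat.mono_iff_injective _).2 (Submodule.injective_subtype _)
        epi_g := (ModuleCat.epi_iff_surjective _).2 hπ }
    haveI : Projective S.X₂ := (IsProjective.iff_projective (Fin k → R)).1 inferInstance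
    obtain ⟨η, hη⟩ := shift hS x
    obtain ⟨s, hs⟩ := ih L η
    obtain ⟨k0, hk0⟩ := a.exists_pow_inf_eq_pow_smul L
    refine ⟨s + k0, ?_⟩
    have hmaps : ∀ v ∈ (a ^ (s + k0) • ⊤ : Submodule R (Fin k → R)),
        π v ∈ (a ^ (s + k0) • ⊤ : Submodule R K) := by
      intro v hv
      have := Submodule.mem_map_of_mem (f := π) hv
      rw [Submodule.map_smul''] at this
      exact Submodule.smul_mono le_rfl le_top this
    let π' : (a ^ (s + k0) • ⊤ : Submodule R (Fin k → R)) →ₗ[R]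
      (a ^ (s + k0) • ⊤ : Submodule R K) := π.restrict hmaps
    have hπ' : Function.Surjective π' := by
      rintro ⟨w, hw⟩
      have e : (a ^ (s + k0) • ⊤ : Submodule R K) =
          Submodule.map π (a ^ (s + k0) • ⊤ : Submodule R (Fin k → R)) := by
        rw [Submodule.map_smul'', Submodule.map_top, LinearMap.range_eq_top.2 hπ]
      have hw' := hw
      rw [e] at hw'
      obtain ⟨v, hv, rfl⟩ := hw'
      exact ⟨⟨v, hv⟩, rfl⟩
    obtain ⟨φ, hφ, g, hg⟩ := kerSeq_map π π' (a ^ (s + k0) • ⊤ : Submodule R (Fin k → R)).subtype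
      (a ^ (s + k0) • ⊤ : Submodule R K).subtype (fun _ => rfl) (a ^ s • ⊤ : Submodule R L) (by
        intro v hv
        apply mem_smul_top_sub
        have h1 : (v : Fin k → R) ∈ (a ^ (s + k0) • ⊤ ⊓ L : Submodule R (Fin k → R)) := ⟨v.2, hv⟩
        rw [hk0 _ (Nat.le_add_left _ _), Nat.add_sub_cancel] at h1
        exact Submodule.smul_mono le_rfl inf_le_right h1)
    have key := hη _ (kerSeq_shortExact π' hπ') φ (by
      rw [hg, ← Abelian.Ext.mk₀_comp_mk₀_assoc, hs, Abelian.Ext.comp_zero])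
    rw [hφ] at key
    exact key

/-- Higher local cohomology of a module killed by `a` vanishes. -/
lemma dies_torsion [IsNoetherianRing R] (a : Ideal R) (N : ModuleCat.{u} R)
    (hN : ∀ r ∈ a, ∀ m : N, r • m = 0) (n : ℕ) : Dies a (n + 1) N := by
  intro t x
  let S (t : ℕ) : ShortComplex (ModuleCat.{u} R) :=
    ShortComplex.mk (ModuleCat.ofHom (Submodule.subtype (a ^ t)))
      (ModuleCat.ofHom (Submodule.mkQ (a ^ t)))
      (by
        rw [← ModuleCat.ofHom_comp, (LinearMap.exact_subtype_mkQ (a ^ t)).linearMap_comp_eq_zero]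
        rfl)
  have hS (t : ℕ) : (S t).ShortExact :=
      { exact := (ShortComplex.ShortExact.moduleCat_exact_iff_function_exact _).2
          (LinearMap.exact_subtype_mkQ _)
        mono_f := (ModuleCat.mono_iff_injective _).2 (Submodule.injective_subtype _)
        epi_g := (ModuleCat.epi_iff_surjective _).2 (Submodule.mkQ_surjective _) }
  haveI : Projective (S t).X₂ := (IsProjective.iff_projective R).1 inferInstance
  obtain ⟨η, hη⟩ := shift (hS t) x
  obtain ⟨s, hs⟩ := pro_zero a N hN n (a ^ t : Ideal R) η
  have hle : t ≤ s + t := Nat.le_add_left _ _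
  refine ⟨s + t, hle, ?_⟩
  let j := Submodule.inclusion (Ideal.pow_le_pow_right (I := a) hle)
  have hj : ∀ v, j v ∈ (a ^ s • ⊤ : Submodule R (a ^ t : Ideal R)) := by
    intro v
    apply mem_smul_top_sub
    change (v : R) ∈ a ^ s • a ^ t
    rw [smul_eq_mul, ← pow_add]
    exact v.2
  let φ : S (s + t) ⟶ S t :=
    { τ₁ := ModuleCat.ofHom j
      τ₂ := 𝟙 _
      τ₃ := pr a hle
      comm₁₂ := rfl
      comm₂₃ := rfl }
  refine hη _ (hS _) φ ?_
  have e : φ.τ₁ = ModuleCat.ofHom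
      (LinearMap.codRestrict (a ^ s • ⊤ : Submodule R (a ^ t : Ideal R)) j hj) ≫
    ModuleCat.ofHom (a ^ s • ⊤ : Submodule R (a ^ t : Ideal R)).subtype := rfl
  rw [e, ← Abelian.Ext.mk₀_comp_mk₀_assoc, hs, Abelian.Ext.comp_zero]

lemma dies_step [IsNoetherianRing R] (a : Ideal R) (M : Type u) [AddCommGroup M] [Module R M]
    (n : ℕ) (h : ∀ p ∈ Module.support R M, Dies a n (ModuleCat.of R (R ⧸ p.asIdeal))) :
    ∀ p ∈ Module.support R M, Dies a (n + 1) (ModuleCat.of R (R ⧸ p.asIdeal)) := by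
  intro p hp
  by_cases hap : a ≤ p.asIdeal
  · apply dies_torsion
    intro r hr m
    obtain ⟨m, rfl⟩ := Submodule.mkQ_surjective _ m
    rw [← map_smul, Submodule.mkQ_apply, Submodule.Quotient.mk_eq_zero, smul_eq_mul]
    exact Ideal.mul_mem_right _ _ (hap hr)
  · obtain ⟨x, hxa, hxp⟩ := SetLike.not_le_iff_exists.1 hap
    apply dies_succ_of_reg _ x hxa
    · intro t u v huv
      obtain ⟨u, rfl⟩ := Submodule.mkQ_surjective _ u
      obtain ⟨v, rfl⟩ := Submodule.mkQ_surjective _ v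
      have huv : (Submodule.Quotient.mk (x ^ t • u) : R ⧸ p.asIdeal) =
        Submodule.Quotient.mk (x ^ t • v) := huv
      rw [Submodule.Quotient.eq, smul_eq_mul, smul_eq_mul, ← mul_sub] at huv
      refine (Submodule.Quotient.eq _).2 ?_
      exact (p.2.mem_or_mem huv).resolve_left fun hh => hxp (p.2.mem_of_pow_mem _ hh)
    · intro t
      apply dies_of_primes (Module.support R M) h
      refine (Module.support_subset_of_surjective _ (Submodule.mkQ_surjective _)).trans ?_
      intro q hq
      rw [Module.support_eq_zeroLocus, Ideal.annihilator_quotient] at hq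
      exact Module.mem_support_mono hq hp

end LCAux

theorem stmt15 (R : Type u) [CommRing R] [IsNoetherianRing R]
    (a : Ideal R) (ha : a ≠ ⊤)
    (M : Type u) [AddCommGroup M] [Module R M] [Module.Finite R M]
    (i : ℕ) (hi : (i : WithBot ℕ∞) ≤ cohDim R a M) :
    ∃ p ∈ Module.support R M, Nontrivial (LC a i (R ⧸ p.asIdeal)) := by
  by_contra hcon
  push Not at hcon
  have h0 : ∀ p ∈ Module.support R M, LCAux.Dies a i (ModuleCat.of R (R ⧸ p.asIdeal)) :=
    fun p hp => (LCAux.subsingleton_iff_dies a i _).1 (hcon p hp)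
  have hall : ∀ m, i ≤ m → ∀ p ∈ Module.support R M,
      LCAux.Dies a m (ModuleCat.of R (R ⧸ p.asIdeal)) := by
    intro m hm
    induction m, hm using Nat.le_induction with
    | base => exact h0
    | succ m _ ih => exact LCAux.dies_step a M m ih
  have hlt : ∀ m, Nontrivial (LC a m M) → m < i := by
    intro m hm
    by_contra hmi
    have := (LCAux.subsingleton_iff_dies a m (ModuleCat.of R M)).2
      (LCAux.dies_of_primes _ (hall m (not_lt.1 hmi)) M subset_rfl)
    exact not_subsingleton _ this
  have hle : cohDim R a M < i := by
    rcases i with _ | k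
    · have : cohDim R a M = ⊥ := by
        unfold cohDim
        rw [sSup_eq_bot]
        rintro x ⟨m, _, hm⟩
        exact absurd (hlt m hm) (Nat.not_lt_zero _)
      rw [this]
      exact WithBot.bot_lt_coe _
    · have : cohDim R a M ≤ ((k : ℕ∞) : WithBot ℕ∞) := by
        apply sSup_le
        rintro x ⟨m, rfl, hm⟩
        have := Nat.lt_succ_iff.1 (hlt m hm)
        exact_mod_cast this
      refine this.trans_lt ?_
      have : k < k + 1 := Nat.lt_succ_self k
      exact_mod_cast this
  exact absurd hi (not_le.2 hle)
end
end
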